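/- For every r ∈ [0,R], the function r ↦ ∫₀^{s(r)} |v_z(r,z)|² dz is differentiable and its derivative equals ṡ(r)·|v_z(r,s(r))|² + (2/α²)·Re[ ∫₀^{s(r)} ((1 + q·β(r,z))/q)·v_r(r,z)·conj(v(r,z)) dz ] − 2λ·Im(1/q)·∫₀^{s(r)} |v_z(r,z)|² dz + 2·Re[ (1/q)·F(v_z;r,s(r))·conj(v(r,s(r))) ] + (2λ/α²)·∫₀^{s(r)} Im(β(r,z)/q)·|v(r,z)|² dz, where F(v_z;r,z) := q·v_{rz}(r,z) − iλ·v_z(r,z). -/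

import Mathlib

open Complex Set MeasureTheory intervalIntegral

/-- Partial derivative in the first (range) variable. -/
noncomputable def pr (f : ℝ → ℝ → ℂ) (r z : ℝ) : ℂ := deriv (fun t => f t z) r

/-- Partial derivative in the second (depth) variable. -/
noncomputable def pz (f : ℝ → ℝ → ℂ) (r z : ℝ) : ℂ := deriv (fun w => f r w) z

/-- The waveguide domain `𝒟 = {(r,z) : 0 ≤ r ≤ R, 0 ≤ z ≤ s(r)}`. -/
def wgDom (R : ℝ) (s : ℝ → ℝ) : Set (ℝ × ℝ) :=
  {p : ℝ × ℝ | p.1 ∈ Icc 0 R ∧ p.2 ∈ Icc 0 (s p.1)}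

/-- Smoothness on an open neighborhood of the domain `𝒟`. -/
def SmoothNearDom (R : ℝ) (s : ℝ → ℝ) (f : ℝ → ℝ → ℂ) : Prop :=
  ∃ U : Set (ℝ × ℝ), IsOpen U ∧ wgDom R s ⊆ U ∧
    ContDiffOn ℝ (⊤ : ℕ∞) (fun p : ℝ × ℝ => f p.1 p.2) U

open Filter Topology

/-- **Leibniz rule**: derivative of a parametric integral whose upper limit depends on the
parameter. -/
theorem hasDerivAt_integral_of_continuousOn {E : Type*} [NormedAddCommGroup E] [NormedSpace ℝ E]
    [CompleteSpace E] {g g' : ℝ → ℝ → E} {U : Set (ℝ × ℝ)} (hU : IsOpen U) {s : ℝ → ℝ}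
    {a r s' : ℝ} (hs : HasDerivAt s s' r) (hsub : ∀ z ∈ uIcc a (s r), (r, z) ∈ U)
    (hg : ContinuousOn (fun p : ℝ × ℝ => g p.1 p.2) U)
    (hg' : ContinuousOn (fun p : ℝ × ℝ => g' p.1 p.2) U)
    (hderiv : ∀ p ∈ U, HasDerivAt (fun t => g t p.2) (g' p.1 p.2) p.1) :
    HasDerivAt (fun t => ∫ z in a..s t, g t z)
      ((∫ z in a..s r, g' r z) + s' • g r (s r)) r := by
  obtain ⟨I, V, hI, hV, hrI, haV, hIV⟩ := generalized_tube_lemma (isCompact_singleton (x := r))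
    (isCompact_uIcc (a := a) (b := s r)) hU (by
      rintro ⟨x, z⟩ ⟨hx, hz⟩
      obtain rfl : x = r := hx
      exact hsub z hz)
  have hI_nhds : I ∈ 𝓝 r := hI.mem_nhds (hrI rfl)
  obtain ⟨δ, hδ, hδI⟩ := Metric.nhds_basis_closedBall.mem_iff.1 hI_nhds
  obtain ⟨ε, hε, hεV⟩ := Metric.isOpen_iff.1 hV (s r) (haV right_mem_uIcc)
  have hslice : ∀ {f : ℝ → ℝ → E}, ContinuousOn (fun p : ℝ × ℝ => f p.1 p.2) U →
      ∀ t ∈ I, ContinuousOn (f t) V := fun hf t ht =>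
    hf.comp (f := fun z => (t, z)) (by fun_prop) fun z hz => hIV ⟨ht, hz⟩
  have hfix : HasDerivAt (fun t => ∫ z in a..s r, g t z) (∫ z in a..s r, g' r z) r := by
    obtain ⟨C, hC⟩ := ((isCompact_closedBall r δ).prod
      (isCompact_uIcc (a := a) (b := s r))).exists_bound_of_continuousOn
        (hg'.mono fun p hp => hIV ⟨hδI hp.1, haV hp.2⟩)
    refine (intervalIntegral.hasDerivAt_integral_of_dominated_loc_of_deriv_le (bound := fun _ => C)
      (Metric.closedBall_mem_nhds r hδ) ?_ ?_ ?_ ?_ ?_ ?_).2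
    · filter_upwards [hI_nhds] with t ht
      exact (((hslice hg t ht).mono haV).mono uIoc_subset_uIcc).aestronglyMeasurable
        measurableSet_uIoc
    · exact ((hslice hg r (hrI rfl)).mono haV).intervalIntegrable
    · exact (((hslice hg' r (hrI rfl)).mono haV).mono uIoc_subset_uIcc).aestronglyMeasurable
        measurableSet_uIoc
    · exact .of_forall fun z hz t ht => hC (t, z) ⟨ht, uIoc_subset_uIcc hz⟩
    · exact intervalIntegrable_const
    · exact .of_forall fun z hz t ht =>
        hderiv (t, z) (hIV ⟨hδI ht, haV (uIoc_subset_uIcc hz)⟩)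
  have hball : ∀ᶠ t in 𝓝 r, uIcc (s r) (s t) ⊆ Metric.ball (s r) ε := by
    filter_upwards [hs.continuousAt.preimage_mem_nhds (Metric.ball_mem_nhds _ hε)] with t ht
    exact (convex_ball (s r) ε).ordConnected.uIcc_subset (Metric.mem_ball_self hε) ht
  have herr : HasDerivAt (fun t => ∫ z in s r..s t, (g t z - g r (s r))) 0 r := by
    rw [hasDerivAt_iff_isLittleO]
    simp only [integral_same, sub_zero, smul_zero]
    refine Asymptotics.IsLittleO.trans_isBigO ?_ hs.isBigO_sub
    rw [Asymptotics.isLittleO_iff]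
    intro c hc
    have hcont := (hg.continuousAt (hU.mem_nhds (hsub _ right_mem_uIcc)))
    obtain ⟨η, hη, hclose⟩ := Metric.continuousAt_iff.1 hcont c hc
    filter_upwards [Metric.ball_mem_nhds r hη,
      hs.continuousAt.preimage_mem_nhds (Metric.ball_mem_nhds _ hη)] with t ht hst
    refine norm_integral_le_of_norm_le_const fun z hz => ?_
    have hz' : z ∈ Metric.ball (s r) η :=
      (convex_ball (s r) η).ordConnected.uIcc_subset (Metric.mem_ball_self hη) hst
        (uIoc_subset_uIcc hz)
    rw [← dist_eq_norm]
    exact (hclose (x := (t, z)) (max_lt ht hz')).le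
  have hconst : HasDerivAt (fun t => (s t - s r) • g r (s r)) (s' • g r (s r)) r :=
    (hs.sub_const _).smul_const _
  refine ((hfix.add herr).add hconst |>.congr_deriv (by rw [add_zero])).congr_of_eventuallyEq ?_
  filter_upwards [hI_nhds, hball] with t ht hst
  have h₁ : IntervalIntegrable (g t) volume a (s r) :=
    ((hslice hg t ht).mono haV).intervalIntegrable
  have h₂ : IntervalIntegrable (g t) volume (s r) (s t) :=
    ((hslice hg t ht).mono (hst.trans hεV)).intervalIntegrable
  simp only [Pi.add_apply]
  rw [integral_sub h₂ intervalIntegrable_const, intervalIntegral.integral_const, add_assoc,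
    sub_add_cancel, integral_add_adjacent_intervals h₁ h₂]

section PartialDerivatives

variable {f : ℝ → ℝ → ℂ} {U : Set (ℝ × ℝ)}

theorem hasDerivAt_fst_of_hasFDerivAt {p : ℝ × ℝ} {L : ℝ × ℝ →L[ℝ] ℂ}
    (h : HasFDerivAt (fun p : ℝ × ℝ => f p.1 p.2) L p) :
    HasDerivAt (fun t => f t p.2) (L (1, 0)) p.1 :=
  h.comp_hasDerivAt (f := fun t => (t, p.2)) p.1
    ((hasDerivAt_id p.1).prodMk (hasDerivAt_const p.1 p.2))

theorem hasDerivAt_snd_of_hasFDerivAt {p : ℝ × ℝ} {L : ℝ × ℝ →L[ℝ] ℂ}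
    (h : HasFDerivAt (fun p : ℝ × ℝ => f p.1 p.2) L p) :
    HasDerivAt (fun z => f p.1 z) (L (0, 1)) p.2 :=
  h.comp_hasDerivAt (f := fun z => (p.1, z)) p.2
    ((hasDerivAt_const p.2 p.1).prodMk (hasDerivAt_id p.2))

theorem ContDiffOn.hasFDerivAt_of_isOpen (hU : IsOpen U)
    (hf : ContDiffOn ℝ (⊤ : ℕ∞) (fun p : ℝ × ℝ => f p.1 p.2) U) {p : ℝ × ℝ} (hp : p ∈ U) :
    HasFDerivAt (fun p : ℝ × ℝ => f p.1 p.2) (fderiv ℝ (fun p : ℝ × ℝ => f p.1 p.2) p) p :=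
  ((hf.contDiffAt (hU.mem_nhds hp)).differentiableAt (by simp)).hasFDerivAt

theorem pr_eq_fderiv (hU : IsOpen U)
    (hf : ContDiffOn ℝ (⊤ : ℕ∞) (fun p : ℝ × ℝ => f p.1 p.2) U) {p : ℝ × ℝ} (hp : p ∈ U) :
    pr f p.1 p.2 = fderiv ℝ (fun p : ℝ × ℝ => f p.1 p.2) p (1, 0) :=
  (hasDerivAt_fst_of_hasFDerivAt (hf.hasFDerivAt_of_isOpen hU hp)).deriv

theorem pz_eq_fderiv (hU : IsOpen U)
    (hf : ContDiffOn ℝ (⊤ : ℕ∞) (fun p : ℝ × ℝ => f p.1 p.2) U) {p : ℝ × ℝ} (hp : p ∈ U) :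
    pz f p.1 p.2 = fderiv ℝ (fun p : ℝ × ℝ => f p.1 p.2) p (0, 1) :=
  (hasDerivAt_snd_of_hasFDerivAt (hf.hasFDerivAt_of_isOpen hU hp)).deriv

theorem hasDerivAt_pr (hU : IsOpen U)
    (hf : ContDiffOn ℝ (⊤ : ℕ∞) (fun p : ℝ × ℝ => f p.1 p.2) U) {p : ℝ × ℝ} (hp : p ∈ U) :
    HasDerivAt (fun t => f t p.2) (pr f p.1 p.2) p.1 :=
  pr_eq_fderiv hU hf hp ▸ hasDerivAt_fst_of_hasFDerivAt (hf.hasFDerivAt_of_isOpen hU hp)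

theorem hasDerivAt_pz (hU : IsOpen U)
    (hf : ContDiffOn ℝ (⊤ : ℕ∞) (fun p : ℝ × ℝ => f p.1 p.2) U) {p : ℝ × ℝ} (hp : p ∈ U) :
    HasDerivAt (fun z => f p.1 z) (pz f p.1 p.2) p.2 :=
  pz_eq_fderiv hU hf hp ▸ hasDerivAt_snd_of_hasFDerivAt (hf.hasFDerivAt_of_isOpen hU hp)

theorem contDiffOn_pr (hU : IsOpen U)
    (hf : ContDiffOn ℝ (⊤ : ℕ∞) (fun p : ℝ × ℝ => f p.1 p.2) U) :
    ContDiffOn ℝ (⊤ : ℕ∞) (fun p : ℝ × ℝ => pr f p.1 p.2) U :=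
  ((hf.fderiv_of_isOpen hU (by simp)).clm_apply contDiffOn_const).congr
    fun _ hp => pr_eq_fderiv hU hf hp

theorem contDiffOn_pz (hU : IsOpen U)
    (hf : ContDiffOn ℝ (⊤ : ℕ∞) (fun p : ℝ × ℝ => f p.1 p.2) U) :
    ContDiffOn ℝ (⊤ : ℕ∞) (fun p : ℝ × ℝ => pz f p.1 p.2) U :=
  ((hf.fderiv_of_isOpen hU (by simp)).clm_apply contDiffOn_const).congr
    fun _ hp => pz_eq_fderiv hU hf hp

/-- Mixed partial derivatives commute. -/
theorem pz_pr_eq_pr_pz (hU : IsOpen U)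
    (hf : ContDiffOn ℝ (⊤ : ℕ∞) (fun p : ℝ × ℝ => f p.1 p.2) U) {p : ℝ × ℝ} (hp : p ∈ U) :
    pz (pr f) p.1 p.2 = pr (pz f) p.1 p.2 := by
  set F : ℝ × ℝ → ℂ := fun p => f p.1 p.2
  have hUp := hU.mem_nhds hp
  have hF : DifferentiableAt ℝ (fderiv ℝ F) p :=
    ((hf.fderiv_of_isOpen (m := (⊤ : ℕ∞)) hU (by simp)).contDiffAt hUp).differentiableAt (by simp)
  have hsymm : IsSymmSndFDerivAt ℝ F p :=
    (hf.contDiffAt hUp).isSymmSndFDerivAt (by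
    simpa using WithTop.coe_le_coe.2 (le_top : (2 : ℕ∞) ≤ ⊤))
  have hsnd (w : ℝ × ℝ) : fderiv ℝ (fun p => fderiv ℝ F p w) p =
      (fderiv ℝ (fderiv ℝ F) p).flip w := by
    rw [(hF.hasFDerivAt.clm_apply (hasFDerivAt_const w p)).fderiv]
    ext <;> simp
  have hr : (fun p : ℝ × ℝ => pr f p.1 p.2) =ᶠ[𝓝 p] fun p => fderiv ℝ F p (1, 0) := by
    filter_upwards [hUp] with x hx using pr_eq_fderiv hU hf hx
  have hz : (fun p : ℝ × ℝ => pz f p.1 p.2) =ᶠ[𝓝 p] fun p => fderiv ℝ F p (0, 1) := by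
    filter_upwards [hUp] with x hx using pz_eq_fderiv hU hf hx
  rw [pz_eq_fderiv hU (contDiffOn_pr hU hf) hp, pr_eq_fderiv hU (contDiffOn_pz hU hf) hp,
    hr.fderiv_eq, hz.fderiv_eq, hsnd, hsnd]
  exact hsymm.eq _ _

end PartialDerivatives

theorem re_intervalIntegral {f : ℝ → ℂ} {a b : ℝ} (hf : IntervalIntegrable f volume a b) :
    (∫ z in a..b, (f z).re) = (∫ z in a..b, f z).re :=
  reCLM.intervalIntegral_comp_comm hf

theorem im_intervalIntegral {f : ℝ → ℂ} {a b : ℝ} (hf : IntervalIntegrable f volume a b) :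
    (∫ z in a..b, (f z).im) = (∫ z in a..b, f z).im :=
  imCLM.intervalIntegral_comp_comm hf

/-- Integration by parts against the conjugate of a function vanishing at the left endpoint. -/
theorem integral_mul_conj_deriv_eq {u u' w w' : ℝ → ℂ} {a b : ℝ}
    (hu : ∀ z ∈ uIcc a b, HasDerivAt u (u' z) z) (hw : ∀ z ∈ uIcc a b, HasDerivAt w (w' z) z)
    (hu' : ContinuousOn u' (uIcc a b)) (hw' : ContinuousOn w' (uIcc a b)) (hwa : w a = 0) :
    ∫ z in a..b, u z * (starRingEnd ℂ) (w' z) =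
      u b * (starRingEnd ℂ) (w b) - ∫ z in a..b, u' z * (starRingEnd ℂ) (w z) := by
  have h := integral_mul_deriv_eq_deriv_mul (v := fun z => (starRingEnd ℂ) (w z))
    (v' := fun z => (starRingEnd ℂ) (w' z)) hu
    (fun z hz => (hw z hz).star) hu'.intervalIntegrable
    (continuous_conj.comp_continuousOn hw').intervalIntegrable
  simpa [hwa] using h

/-- Identity (2.3): the derivative of `r ↦ ∫₀^{s(r)} |v_z(r,z)|² dz` equals
`ṡ(r)|v_z(r,s(r))|² + (2/α²) Re ∫ ((1+qβ)/q) v_r conj v dz - 2λ Im(1/q) ‖v_z‖²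
 + 2 Re[(1/q) F(v_z;r,s(r)) conj v(r,s(r))] + (2λ/α²) ∫ Im(β/q) |v|² dz`,
where `F(w;r,z) = q w_r - iλ w`. -/
theorem stmt_1 (R α : ℝ) (q : ℂ) (lam : ℝ) (s : ℝ → ℝ) (β v : ℝ → ℝ → ℂ)
    (hR : 0 < R) (hα : 0 < α) (hq : q ≠ 0) (hlam : lam ≠ 0)
    (hs : ContDiff ℝ 1 s) (hspos : ∀ r ∈ Icc (0:ℝ) R, 0 < s r)
    (hβ : SmoothNearDom R s β) (hv : SmoothNearDom R s v)
    (hpde : ∀ r ∈ Icc (0:ℝ) R, ∀ z ∈ Icc (0:ℝ) (s r),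
      (1 + q * β r z) * pr v r z + (α : ℂ) ^ 2 * q * pr (pz (pz v)) r z
        = Complex.I * (lam : ℂ) * ((α : ℂ) ^ 2 * pz (pz v) r z + β r z * v r z))
    (hsurf : ∀ r ∈ Icc (0:ℝ) R, v r 0 = 0) :
    ∀ r ∈ Icc (0:ℝ) R,
      HasDerivWithinAt (fun t => ∫ z in (0:ℝ)..(s t), ‖pz v t z‖ ^ 2)
        (deriv s r * ‖pz v r (s r)‖ ^ 2
          + (2 / α ^ 2) * (∫ z in (0:ℝ)..(s r),
              ((1 + q * β r z) / q) * pr v r z * (starRingEnd ℂ) (v r z)).re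
          - 2 * lam * (1 / q).im * (∫ z in (0:ℝ)..(s r), ‖pz v r z‖ ^ 2)
          + 2 * ((1 / q) *
              (q * pr (pz v) r (s r) - Complex.I * (lam : ℂ) * pz v r (s r))
              * (starRingEnd ℂ) (v r (s r))).re
          + (2 * lam / α ^ 2) * (∫ z in (0:ℝ)..(s r), (β r z / q).im * ‖v r z‖ ^ 2))
        (Icc 0 R) r := by
  intro r hr
  obtain ⟨U, hU, hDU, hvU⟩ := hv
  obtain ⟨W, hW, hDW, hβW⟩ := hβ
  have hsr := hspos r hr
  have huIcc : uIcc 0 (s r) = Icc 0 (s r) := uIcc_of_le hsr.le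
  have hmemU : ∀ z ∈ uIcc 0 (s r), (r, z) ∈ U := fun z hz => hDU ⟨hr, huIcc ▸ hz⟩
  have hmemW : ∀ z ∈ uIcc 0 (s r), (r, z) ∈ W := fun z hz => hDW ⟨hr, huIcc ▸ hz⟩
  have hvz := contDiffOn_pz hU hvU
  have hvrz := contDiffOn_pr hU hvz
  have hvzz := contDiffOn_pz hU hvz
  have hslice : ∀ {f : ℝ → ℝ → ℂ},
      ContDiffOn ℝ (⊤ : ℕ∞) (fun p : ℝ × ℝ => f p.1 p.2) U →
      ContinuousOn (f r) (uIcc 0 (s r)) := fun hf =>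
    hf.continuousOn.comp (f := fun z => (r, z)) (by fun_prop) hmemU
  have cv := hslice hvU
  have cvr := hslice (contDiffOn_pr hU hvU)
  have cvz := hslice hvz
  have cvrz := hslice hvrz
  have cvzz := hslice hvzz
  have cvrzz := hslice (contDiffOn_pr hU hvzz)
  have cβ : ContinuousOn (β r) (uIcc 0 (s r)) :=
    hβW.continuousOn.comp (f := fun z => (r, z)) (by fun_prop) hmemW
  have cconj : ContinuousOn (fun z => (starRingEnd ℂ) (v r z)) (uIcc 0 (s r)) :=
    continuous_conj.comp_continuousOn cv
  have cconjz : ContinuousOn (fun z => (starRingEnd ℂ) (pz v r z)) (uIcc 0 (s r)) :=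
    continuous_conj.comp_continuousOn cvz
  have dv : ∀ z ∈ uIcc 0 (s r), HasDerivAt (v r) (pz v r z) z := fun z hz =>
    hasDerivAt_pz hU hvU (hmemU z hz)
  have dvz : ∀ z ∈ uIcc 0 (s r), HasDerivAt (pz v r) (pz (pz v) r z) z := fun z hz =>
    hasDerivAt_pz hU hvz (hmemU z hz)
  have dvrz : ∀ z ∈ uIcc 0 (s r), HasDerivAt (pr (pz v) r) (pr (pz (pz v)) r z) z :=
    fun z hz => pz_pr_eq_pr_pz hU hvz (hmemU z hz) ▸ hasDerivAt_pz hU hvrz (hmemU z hz)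
  have hleib := hasDerivAt_integral_of_continuousOn (g := fun t z => ‖pz v t z‖ ^ 2)
    (g' := fun t z => 2 * inner ℝ (pz v t z) (pr (pz v) t z)) hU
    ((hs.differentiable one_ne_zero r).hasDerivAt) hmemU
    (hvz.continuousOn.norm.pow 2)
    (continuousOn_const.mul (hvz.continuousOn.inner hvrz.continuousOn))
    (fun p hp => (hasDerivAt_pr hU hvz hp).norm_sq)
  refine (hleib.congr_deriv ?_).hasDerivWithinAt
  set IA : ℂ := ∫ z in (0:ℝ)..(s r),
    ((1 + q * β r z) / q) * pr v r z * (starRingEnd ℂ) (v r z) with hIA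
  have hrate : (∫ z in (0:ℝ)..(s r), 2 * inner ℝ (pz v r z) (pr (pz v) r z)) =
      2 * (∫ z in (0:ℝ)..(s r), pr (pz v) r z * (starRingEnd ℂ) (pz v r z)).re := by
    rw [intervalIntegral.integral_const_mul,
      ← re_intervalIntegral
        (f := fun z => pr (pz v) r z * (starRingEnd ℂ) (pz v r z)) (cvrz.mul cconjz).intervalIntegrable]
    simp only [Complex.inner]
  have hparts := integral_mul_conj_deriv_eq dvrz dv cvrzz cvz (hsurf r hr)
  have hparts' := integral_mul_conj_deriv_eq dvz dv cvzz cvz (hsurf r hr)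
  have henergy : (∫ z in (0:ℝ)..(s r), pz v r z * (starRingEnd ℂ) (pz v r z)) =
      ((∫ z in (0:ℝ)..(s r), ‖pz v r z‖ ^ 2 : ℝ) : ℂ) := by
    rw [← intervalIntegral.integral_ofReal]
    simp only [mul_conj', ofReal_pow]
  have hpot : (∫ z in (0:ℝ)..(s r), (β r z / q).im * ‖v r z‖ ^ 2) =
      (∫ z in (0:ℝ)..(s r), β r z / q * (v r z * (starRingEnd ℂ) (v r z))).im := by
    rw [← im_intervalIntegral
      (f := fun z => β r z / q * (v r z * (starRingEnd ℂ) (v r z))) ((cβ.div_const q).mul (cv.mul cconj)).intervalIntegrable]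
    simp only [mul_conj', ← ofReal_pow, im_mul_ofReal]
  have hα' : (α : ℂ) ≠ 0 := ofReal_ne_zero.2 hα.ne'
  have hmodel : (∫ z in (0:ℝ)..(s r), pr (pz (pz v)) r z * (starRingEnd ℂ) (v r z)) =
      I * lam / q * (∫ z in (0:ℝ)..(s r), pz (pz v) r z * (starRingEnd ℂ) (v r z))
      + I * lam / α ^ 2 *
        (∫ z in (0:ℝ)..(s r), β r z / q * (v r z * (starRingEnd ℂ) (v r z)))
      - 1 / α ^ 2 * IA := by
    have i₁ : IntervalIntegrable (fun z => I * lam / q *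
        (pz (pz v) r z * (starRingEnd ℂ) (v r z))) volume 0 (s r) :=
      (cvzz.mul cconj).intervalIntegrable.const_mul _
    have i₂ : IntervalIntegrable (fun z => I * lam / α ^ 2 *
        (β r z / q * (v r z * (starRingEnd ℂ) (v r z)))) volume 0 (s r) :=
      ((cβ.div_const q).mul (cv.mul cconj)).intervalIntegrable.const_mul _
    have i₃ : IntervalIntegrable (fun z => 1 / (α : ℂ) ^ 2 *
        ((1 + q * β r z) / q * pr v r z * (starRingEnd ℂ) (v r z))) volume 0 (s r) :=
      (((((continuousOn_const (c := (1 : ℂ))).add ((continuousOn_const (c := q)).mul cβ)).div_const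
        q).mul cvr).mul cconj).intervalIntegrable.const_mul _
    rw [hIA, ← intervalIntegral.integral_const_mul, ← intervalIntegral.integral_const_mul,
      ← intervalIntegral.integral_const_mul, ← integral_add i₁ i₂, ← integral_sub (i₁.add i₂) i₃]
    refine integral_congr fun z hz => ?_
    have h := hpde r hr z (huIcc ▸ hz)
    have hsolve : pr (pz (pz v)) r z = (I * lam * (α ^ 2 * pz (pz v) r z + β r z * v r z)
        - (1 + q * β r z) * pr v r z) / (α ^ 2 * q) := by
      rw [eq_div_iff (by positivity)]
      linear_combination h
    simp only [hsolve]
    field_simp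
  rw [henergy] at hparts'
  rw [eq_sub_iff_add_eq', ← eq_sub_iff_add_eq] at hparts'
  rw [hrate, hparts, hmodel, hparts', hpot]
  set P : ℂ := ∫ z in (0:ℝ)..(s r), β r z / q * (v r z * (starRingEnd ℂ) (v r z))
  set N : ℝ := ∫ z in (0:ℝ)..(s r), ‖pz v r z‖ ^ 2
  set c := pr (pz v) r (s r)
  set b := pz v r (s r)
  set a := (starRingEnd ℂ) (v r (s r))
  have hsplit : c * a - (I * lam / q * (b * a - N) + I * lam / α ^ 2 * P - 1 / α ^ 2 * IA) =
      ((1 / α ^ 2 : ℝ) : ℂ) * IA + 1 / q * (q * c - I * lam * b) * a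
        + ((lam * N : ℝ) : ℂ) * (I * (1 / q)) - ((lam / α ^ 2 : ℝ) : ℂ) * (I * P) := by
    push_cast
    field_simp
    ring
  rw [hsplit, sub_re, add_re, add_re, re_ofReal_mul, re_ofReal_mul, re_ofReal_mul, I_mul_re,
    I_mul_re, smul_eq_mul]
  ring
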